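/- Let S₁ and S₂ be skew-adjacency matrices of tournaments on p and q vertices respectively, with p and q both odd. Then det [[S₁, J], [−Jᵀ, S₂]] = 1 if and only if det S₁⁺ = 1 and det S₂⁺ = 1, where S⁺ denotes S bordered by a final all-ones column and a final all-minus-ones row. -/

import Mathlib

open Matrix

/-- A skew-adjacency matrix of a tournament: zero diagonal, skew-symmetric,
off-diagonal entries in `{-1, 1}`. -/
def IsTournament {n : ℕ} (S : Matrix (Fin n) (Fin n) ℤ) : Prop :=
  (∀ i, S i i = 0) ∧ Sᵀ = -S ∧ ∀ i j, i ≠ j → S i j = 1 ∨ S i j = -1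

/-- `S⁺` : the skew-adjacency matrix of `T⁺`, obtained from `S` by appending a
last column of all ones and a last row of all minus-ones, with corner entry `0`. -/
def plusOne {n : ℕ} (S : Matrix (Fin n) (Fin n) ℤ) : Matrix (Fin (n + 1)) (Fin (n + 1)) ℤ :=
  Matrix.of fun i j =>
    if hi : (i : ℕ) < n then
      (if hj : (j : ℕ) < n then S ⟨i, hi⟩ ⟨j, hj⟩ else 1)
    else (if (j : ℕ) < n then -1 else 0)

namespace Matrix

section Border

variable {R : Type*} [Ring R] {m n : Type*}

/-- The block matrix with diagonal blocks `A`, `D`, all-ones upper right block and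
all-minus-ones lower left block. -/
def joinBlocks (A : Matrix m m R) (D : Matrix n n R) : Matrix (m ⊕ n) (m ⊕ n) R :=
  fromBlocks A (of fun _ _ => 1) (of fun _ _ => -1) D

theorem joinBlocks_map_intCast (A : Matrix m m ℤ) (D : Matrix n n ℤ) :
    (joinBlocks A D).map (Int.cast : ℤ → R) = joinBlocks (A.map Int.cast) (D.map Int.cast) := by
  ext (i | i) (j | j) <;> simp [joinBlocks]

theorem transpose_joinBlocks {A : Matrix m m R} {D : Matrix n n R} (hA : Aᵀ = -A) (hD : Dᵀ = -D) :
    (joinBlocks A D)ᵀ = -joinBlocks A D := by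
  rw [joinBlocks, fromBlocks_transpose, fromBlocks_neg, hA, hD]
  congr 1
  ext
  simp

end Border

section Field

variable {K : Type*} [Field K] {m n : Type*} [Fintype m] [Fintype n] [DecidableEq m]
  [DecidableEq n]

theorem det_joinBlocks_eq_det_mul {A : Matrix m m K} (hA : A.det ≠ 0) (D : Matrix n n K) :
    (joinBlocks A D).det =
      A.det * (D + of fun _ _ => (1 : m → K) ⬝ᵥ A⁻¹ *ᵥ 1).det := by
  let := A.invertibleOfIsUnitDet hA.isUnit
  rw [joinBlocks, det_fromBlocks₁₁]
  congr 2
  ext i j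
  simp [mul_apply, dotProduct, mulVec, Finset.sum_neg_distrib]
  exact Finset.sum_comm

theorem det_add_const {D : Matrix n n K} (hD : D.det ≠ 0) (x : K) :
    (D + of fun _ _ => x).det = D.det * (1 + x * ((1 : n → K) ⬝ᵥ D⁻¹ *ᵥ 1)) := by
  have h : (of fun _ _ => x : Matrix n n K) =
      replicateCol Unit (fun _ => x) * replicateRow Unit (fun _ => (1 : K)) := by
    ext; simp [mul_apply]
  rw [h, det_add_replicateCol_mul_replicateRow hD.isUnit]
  simp [mul_apply, dotProduct, mulVec, Finset.sum_mul, Finset.mul_sum]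
  left
  rw [Finset.sum_comm]
  simp [mul_comm]

theorem det_joinBlocks_of_det_ne_zero {A : Matrix m m K} {D : Matrix n n K} (hA : A.det ≠ 0)
    (hD : D.det ≠ 0) :
    (joinBlocks A D).det = A.det * D.det +
      (joinBlocks A (0 : Matrix (Fin 1) (Fin 1) K)).det *
        (joinBlocks D (0 : Matrix (Fin 1) (Fin 1) K)).det := by
  simp only [det_joinBlocks_eq_det_mul hA, det_joinBlocks_eq_det_mul hD, det_add_const hD,
    det_fin_one, add_apply, zero_apply, of_apply]
  ring

end Field

section Skew

variable {m n : Type*} [Fintype m] [Fintype n] [DecidableEq m] [DecidableEq n]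

theorem det_smul_one_add_smul_ne_zero {S : Matrix n n ℝ} (hS : Sᵀ = -S) {t : ℝ} (ht : t ≠ 0)
    (c : ℝ) : (t • (1 : Matrix n n ℝ) + c • S).det ≠ 0 := by
  intro h
  obtain ⟨v, hv, hv0⟩ := exists_mulVec_eq_zero_iff.mpr h
  have hskew : v ⬝ᵥ S *ᵥ v = 0 := by
    have h1 : v ⬝ᵥ S *ᵥ v = -(v ⬝ᵥ S *ᵥ v) := by
      conv_lhs => rw [dotProduct_mulVec, ← mulVec_transpose, hS, neg_mulVec, neg_dotProduct,
        dotProduct_comm]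
    linarith
  have h2 := congrArg (v ⬝ᵥ ·) hv0
  simp only [add_mulVec, smul_mulVec, one_mulVec, dotProduct_add, dotProduct_smul, hskew,
    dotProduct_zero, smul_eq_mul, mul_zero, add_zero, mul_eq_zero, ht, false_or,
    dotProduct_self_eq_zero] at h2
  exact hv h2

theorem det_nonneg_of_transpose_eq_neg {S : Matrix n n ℝ} (hS : Sᵀ = -S) : 0 ≤ S.det := by
  by_contra! hneg
  let f : ℝ → ℝ := fun t => (t • (1 : Matrix n n ℝ) + (1 - t) • S).det
  have hf : Continuous f := by
    refine Continuous.matrix_det ?_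
    fun_prop
  have hf0 : f 0 = S.det := by simp [f]
  have hf1 : f 1 = 1 := by simp [f]
  obtain ⟨t, -, ht⟩ := intermediate_value_Icc zero_le_one hf.continuousOn
    (show (0 : ℝ) ∈ Set.Icc (f 0) (f 1) by rw [hf0, hf1]; exact ⟨hneg.le, zero_le_one⟩)
  have ht0 : t ≠ 0 := by
    rintro rfl
    exact hneg.ne (hf0.symm.trans ht)
  exact det_smul_one_add_smul_ne_zero hS ht0 _ ht

theorem det_eq_zero_of_transpose_eq_neg {S : Matrix n n ℝ} (hS : Sᵀ = -S)
    (hn : Odd (Fintype.card n)) : S.det = 0 := by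
  have h := det_transpose S
  rw [hS, det_neg, hn.neg_one_pow] at h
  linarith

theorem det_joinBlocks_of_transpose_eq_neg {A : Matrix m m ℝ} {D : Matrix n n ℝ} (hA : Aᵀ = -A)
    (hD : Dᵀ = -D) :
    (joinBlocks A D).det = A.det * D.det +
      (joinBlocks A (0 : Matrix (Fin 1) (Fin 1) ℝ)).det *
        (joinBlocks D (0 : Matrix (Fin 1) (Fin 1) ℝ)).det := by
  let a : ℝ → Matrix m m ℝ := fun t => t • 1 + (1 : ℝ) • A
  let d : ℝ → Matrix n n ℝ := fun t => t • 1 + (1 : ℝ) • D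
  have ha : Continuous a := by fun_prop
  have hd : Continuous d := by fun_prop
  have hEq : Set.EqOn (fun t => (joinBlocks (a t) (d t)).det)
      (fun t => (a t).det * (d t).det + (joinBlocks (a t) (0 : Matrix (Fin 1) (Fin 1) ℝ)).det *
        (joinBlocks (d t) (0 : Matrix (Fin 1) (Fin 1) ℝ)).det) (Set.Ioi 0) := fun t ht =>
    det_joinBlocks_of_det_ne_zero (det_smul_one_add_smul_ne_zero hA (ne_of_gt ht) 1)
      (det_smul_one_add_smul_ne_zero hD (ne_of_gt ht) 1)
  have h0 := hEq.closure (by unfold joinBlocks; fun_prop) (by unfold joinBlocks; fun_prop)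
    (show (0 : ℝ) ∈ closure (Set.Ioi 0) by simp)
  simpa [a, d] using h0

end Skew

end Matrix

theorem det_plusOne {n : ℕ} (S : Matrix (Fin n) (Fin n) ℤ) :
    (plusOne S).det = (joinBlocks S (0 : Matrix (Fin 1) (Fin 1) ℤ)).det := by
  rw [← det_submatrix_equiv_self finSumFinEquiv (plusOne S)]
  congr 1
  ext (i | i) (j | j) <;> simp [plusOne, joinBlocks]

theorem det_plusOne_nonneg {n : ℕ} {S : Matrix (Fin n) (Fin n) ℤ} (hS : Sᵀ = -S) :
    0 ≤ (plusOne S).det := by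
  have h := det_nonneg_of_transpose_eq_neg
    (S := (joinBlocks S (0 : Matrix (Fin 1) (Fin 1) ℤ)).map (Int.cast : ℤ → ℝ)) (by
      rw [← transpose_map, transpose_joinBlocks hS (by simp)]
      ext
      simp)
  rw [← Int.cast_det] at h
  rw [det_plusOne]
  exact_mod_cast h

theorem det_joinBlocks_eq_mul_det_plusOne {p q : ℕ} (hp : Odd p)
    {S₁ : Matrix (Fin p) (Fin p) ℤ} {S₂ : Matrix (Fin q) (Fin q) ℤ} (hS₁ : S₁ᵀ = -S₁)
    (hS₂ : S₂ᵀ = -S₂) :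
    (joinBlocks S₁ S₂).det = (plusOne S₁).det * (plusOne S₂).det := by
  have cast_skew {n : ℕ} {S : Matrix (Fin n) (Fin n) ℤ} (hS : Sᵀ = -S) :
      (S.map (Int.cast : ℤ → ℝ))ᵀ = -S.map Int.cast := by
    rw [← transpose_map, hS]
    ext
    simp
  have h := det_joinBlocks_of_transpose_eq_neg (cast_skew hS₁) (cast_skew hS₂)
  rw [det_eq_zero_of_transpose_eq_neg (cast_skew hS₁) (by simpa using hp), zero_mul, zero_add,
    ← Matrix.map_zero (Int.cast : ℤ → ℝ) Int.cast_zero] at h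
  simp only [← joinBlocks_map_intCast, ← Int.cast_det] at h
  rw [det_plusOne, det_plusOne]
  exact_mod_cast h

theorem join_unimodular_iff_odd {p q : ℕ} (hp : Odd p) (hq : Odd q)
    (S₁ : Matrix (Fin p) (Fin p) ℤ) (S₂ : Matrix (Fin q) (Fin q) ℤ)
    (hS₁ : IsTournament S₁) (hS₂ : IsTournament S₂) :
    (Matrix.fromBlocks S₁ (Matrix.of fun _ _ => (1 : ℤ))
      (Matrix.of fun _ _ => (-1 : ℤ)) S₂).det = 1 ↔
      (plusOne S₁).det = 1 ∧ (plusOne S₂).det = 1 := by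
  have h := det_joinBlocks_eq_mul_det_plusOne hp hS₁.2.1 hS₂.2.1
  rw [joinBlocks] at h
  have h₁ := det_plusOne_nonneg hS₁.2.1
  rw [h, Int.mul_eq_one_iff_eq_one_or_neg_one]
  omega
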